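/- Let (V,g) be an n-dimensional 2-symmetric semi-Riemannian manifold of any signature and let T_{α₁…α_q} be a tensor field with ∇_λ∇_μ T_{α₁…α_q} = 0. Then the Ricci tensor satisfies (∇_ν R^{ρ}_{μ} − ∇_μ R^{ρ}_{ν}) ∇_ρ T_{α₁…α_q} = 0 and (∇^{ρ} R_{μν} − 2 ∇_ν R^{ρ}_{μ}) ∇_ρ T_{α₁…α_q} = 0. -/

import Mathlib

noncomputable section

open scoped BigOperators

/-! ## A local-coordinate framework for semi-Riemannian geometry

A semi-Riemannian manifold is described in a local chart: points are elements of
`Pt n := Fin n → ℝ`, a rank-`q` covariant tensor field is a map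
`Pt n → (Fin q → Fin n) → ℝ`, the metric `g` (with inverse `ginv`) determines the
Christoffel symbols of its Levi-Civita connection, the covariant derivative `covD`,
and the Riemann, Ricci, scalar and Weyl curvatures. -/

/-- Points of a local chart of an `n`-dimensional manifold. -/
abbrev Pt (n : ℕ) : Type := Fin n → ℝ

/-- A rank-`q` (covariant) tensor field, in the chart. -/
abbrev Tensor (n q : ℕ) : Type := Pt n → (Fin q → Fin n) → ℝ

/-- Partial derivative of a scalar field in the `i`-th coordinate direction. -/
def pd {n : ℕ} (i : Fin n) (f : Pt n → ℝ) (x : Pt n) : ℝ :=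
  fderiv ℝ f x (Pi.single i 1)

/-- `g` is a smooth metric of arbitrary signature, with (smooth) inverse `ginv`. -/
def IsMetric {n : ℕ} (g ginv : Pt n → Fin n → Fin n → ℝ) : Prop :=
  (∀ x μ ν, g x μ ν = g x ν μ) ∧
  (∀ μ ν, ContDiff ℝ (⊤ : ℕ∞) fun x => g x μ ν) ∧
  (∀ μ ν, ContDiff ℝ (⊤ : ℕ∞) fun x => ginv x μ ν) ∧
  (∀ x μ ν, (∑ ρ, ginv x μ ρ * g x ρ ν) = if μ = ν then (1 : ℝ) else 0)

/-- The metric `g` has Lorentzian signature `(-,+,…,+)`: at every point there is a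
frame in which it takes the form `diag (-1, 1, …, 1)`. -/
def IsLorentzian {n : ℕ} (g : Pt n → Fin n → Fin n → ℝ) : Prop :=
  ∀ x, ∃ e : Fin n → Fin n → ℝ, ∀ μ ν : Fin n,
    (∑ α, ∑ β, g x α β * e μ α * e ν β) =
      if μ = ν then (if μ.val = 0 then (-1 : ℝ) else 1) else 0

/-- Christoffel symbols `Γ^α_{βγ}` of the Levi-Civita connection of `g`. -/
def christoffel {n : ℕ} (g ginv : Pt n → Fin n → Fin n → ℝ) (x : Pt n) (α β γ : Fin n) : ℝ :=
  (1 / 2) * ∑ ρ, ginv x α ρ *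
    (pd β (fun y => g y ρ γ) x + pd γ (fun y => g y ρ β) x - pd ρ (fun y => g y β γ) x)

/-- Covariant derivative of a rank-`q` covariant tensor field:
`(covD T)_{λ α₁ … α_q} = ∇_λ T_{α₁ … α_q}`; the derivative index comes first. -/
def covD {n q : ℕ} (g ginv : Pt n → Fin n → Fin n → ℝ) (T : Tensor n q) :
    Tensor n (q + 1) := fun x idx =>
  pd (idx 0) (fun y => T y fun i => idx i.succ) x -
    ∑ i : Fin q, ∑ ρ, christoffel g ginv x ρ (idx 0) (idx i.succ) *
      T x (Function.update (fun j => idx j.succ) i ρ)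

/-- Covariant derivative `∇_λ k^μ` of a vector field `k^μ`. -/
def covDVec {n : ℕ} (g ginv : Pt n → Fin n → Fin n → ℝ) (k : Pt n → Fin n → ℝ)
    (x : Pt n) (lam μ : Fin n) : ℝ :=
  pd lam (fun y => k y μ) x + ∑ ρ, christoffel g ginv x μ lam ρ * k x ρ

/-- Riemann curvature tensor `R^α_{βγδ}` of the Levi-Civita connection of `g`. -/
def riemannUp {n : ℕ} (g ginv : Pt n → Fin n → Fin n → ℝ) (x : Pt n) (α β γ δ : Fin n) : ℝ :=
  pd γ (fun y => christoffel g ginv y α δ β) x - pd δ (fun y => christoffel g ginv y α γ β) x +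
    ∑ ρ, (christoffel g ginv x α γ ρ * christoffel g ginv x ρ δ β -
          christoffel g ginv x α δ ρ * christoffel g ginv x ρ γ β)

/-- Fully covariant Riemann tensor `R_{αβγδ} = g_{αρ} R^ρ_{βγδ}`. -/
def riemann {n : ℕ} (g ginv : Pt n → Fin n → Fin n → ℝ) : Tensor n 4 := fun x idx =>
  ∑ ρ, g x (idx 0) ρ * riemannUp g ginv x ρ (idx 1) (idx 2) (idx 3)

/-- Ricci tensor `R_{μν} = R^ρ_{μρν}`. -/
def ricci {n : ℕ} (g ginv : Pt n → Fin n → Fin n → ℝ) : Tensor n 2 := fun x idx =>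
  ∑ ρ, riemannUp g ginv x ρ (idx 0) ρ (idx 1)

/-- Scalar curvature `R = g^{μν} R_{μν}`. -/
def scalarCurv {n : ℕ} (g ginv : Pt n → Fin n → Fin n → ℝ) (x : Pt n) : ℝ :=
  ∑ μ, ∑ ν, ginv x μ ν * ricci g ginv x ![μ, ν]

/-- Weyl conformal tensor `C_{αβλμ}`, defined through the standard decomposition
`R_{αβλμ} = C_{αβλμ} + (2/(n-2)) (R_{α[λ} g_{μ]β} - R_{β[λ} g_{μ]α})
 - (R/((n-1)(n-2))) (g_{αλ} g_{βμ} - g_{αμ} g_{βλ})`. -/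
def weyl {n : ℕ} (g ginv : Pt n → Fin n → Fin n → ℝ) : Tensor n 4 := fun x idx =>
  riemann g ginv x idx -
    (2 / ((n : ℝ) - 2)) *
      ((ricci g ginv x ![idx 0, idx 2] * g x (idx 3) (idx 1) -
        ricci g ginv x ![idx 0, idx 3] * g x (idx 2) (idx 1)) / 2 -
       (ricci g ginv x ![idx 1, idx 2] * g x (idx 3) (idx 0) -
        ricci g ginv x ![idx 1, idx 3] * g x (idx 2) (idx 0)) / 2) +
    (scalarCurv g ginv x / (((n : ℝ) - 1) * ((n : ℝ) - 2))) *
      (g x (idx 0) (idx 2) * g x (idx 1) (idx 3) - g x (idx 0) (idx 3) * g x (idx 1) (idx 2))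

/-- Second-order symmetry (2-symmetry): `∇_μ ∇_ν R_{αβγδ} = 0` everywhere. -/
def TwoSymmetric {n : ℕ} (g ginv : Pt n → Fin n → Fin n → ℝ) : Prop :=
  ∀ x idx, covD g ginv (covD g ginv (riemann g ginv)) x idx = 0

/-- 2-symmetry on a set `D`: `∇_μ ∇_ν R_{αβγδ} = 0` on `D`. -/
def TwoSymmetricOn {n : ℕ} (g ginv : Pt n → Fin n → Fin n → ℝ) (D : Set (Pt n)) : Prop :=
  ∀ x ∈ D, ∀ idx, covD g ginv (covD g ginv (riemann g ginv)) x idx = 0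

/-- Semi-symmetry: `∇_[μ ∇_ν] R_{αβγδ} = 0` everywhere. -/
def SemiSymmetric {n : ℕ} (g ginv : Pt n → Fin n → Fin n → ℝ) : Prop :=
  ∀ x (μ ν α β γ δ : Fin n),
    covD g ginv (covD g ginv (riemann g ginv)) x ![μ, ν, α, β, γ, δ] =
    covD g ginv (covD g ginv (riemann g ginv)) x ![ν, μ, α, β, γ, δ]

/-- `p` is a generic point: the Riemann tensor at `p`, viewed as the endomorphism
`ω_{γδ} ↦ R^{αβ}_{γδ} ω_{γδ}` of the space of 2-forms at `p`, is non-singular. -/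
def GenericAt {n : ℕ} (g ginv : Pt n → Fin n → Fin n → ℝ) (p : Pt n) : Prop :=
  ∀ ω : Fin n → Fin n → ℝ, (∀ γ δ, ω γ δ = -ω δ γ) →
    (∀ α β, (∑ γ, ∑ δ, (∑ σ, ginv p β σ * riemannUp g ginv p α σ γ δ) * ω γ δ) = 0) →
    ω = 0

/-- `k` is a parallel null (nowhere zero) vector field on `D`. -/
def ParallelNullVectorFieldOn {n : ℕ} (g ginv : Pt n → Fin n → Fin n → ℝ)
    (D : Set (Pt n)) (k : Pt n → Fin n → ℝ) : Prop :=
  (∀ x ∈ D, ∀ lam μ, covDVec g ginv k x lam μ = 0) ∧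
  (∀ x ∈ D, (∑ μ, ∑ ν, g x μ ν * k x μ * k x ν) = 0) ∧
  (∀ x ∈ D, k x ≠ 0)

/-- Pullback metric of `g` along a coordinate change `φ`. -/
def pullback {n : ℕ} (g : Pt n → Fin n → Fin n → ℝ) (φ : Pt n → Pt n)
    (x : Pt n) (μ ν : Fin n) : ℝ :=
  ∑ α, ∑ β, g (φ x) α β * pd μ (fun y => φ y α) x * pd ν (fun y => φ y β) x

/-- `k`-th iterated covariant derivative of a rank-`q` tensor field. -/
def covDIter {n : ℕ} (g ginv : Pt n → Fin n → Fin n → ℝ) (q : ℕ) :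
    (k : ℕ) → Tensor n q → Tensor n (q + k)
  | 0, T => T
  | k + 1, T => covD g ginv (covDIter g ginv q k T)

/-- Totally antisymmetric Levi-Civita symbol. -/
def lcSymbol {n : ℕ} (idx : Fin n → Fin n) : ℝ :=
  if h : Function.Bijective idx then ((Equiv.Perm.sign (Equiv.ofBijective idx h) : ℤ) : ℝ) else 0

/-- The metric volume element `n`-form `√|det g| ε_{μ₁…μ_n}`. -/
def volForm {n : ℕ} (g : Pt n → Fin n → Fin n → ℝ) : Tensor n n := fun x idx =>
  Real.sqrt |Matrix.det (Matrix.of (g x))| * lcSymbol idx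

/-- Formal curvature invariants of rank `q`: tensor fields constructed polynomially
from the metric, its inverse, the Riemann tensor, the volume `n`-form, covariant
derivatives, tensor products, (metric) contractions, index permutations, sums and
scalar multiples. -/
inductive TExpr (n : ℕ) : ℕ → Type where
  | metric : TExpr n 2
  | inv : TExpr n 2
  | riem : TExpr n 4
  | eps : TExpr n n
  | cd : {q : ℕ} → TExpr n q → TExpr n (q + 1)
  | tprod : {q r : ℕ} → TExpr n q → TExpr n r → TExpr n (q + r)
  | contr : {q : ℕ} → TExpr n (q + 2) → TExpr n q
  | permute : {q : ℕ} → Equiv.Perm (Fin q) → TExpr n q → TExpr n q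
  | add : {q : ℕ} → TExpr n q → TExpr n q → TExpr n q
  | smul : {q : ℕ} → ℝ → TExpr n q → TExpr n q

/-- Evaluation of a formal curvature invariant as a tensor field. -/
def TExpr.eval {n : ℕ} (g ginv : Pt n → Fin n → Fin n → ℝ) :
    {q : ℕ} → TExpr n q → Tensor n q
  | _, .metric => fun x idx => g x (idx 0) (idx 1)
  | _, .inv => fun x idx => ginv x (idx 0) (idx 1)
  | _, .riem => riemann g ginv
  | _, .eps => volForm g
  | _, .cd e => covD g ginv (TExpr.eval g ginv e)
  | _, .tprod e₁ e₂ => fun x idx =>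
      TExpr.eval g ginv e₁ x (fun i => idx (Fin.castAdd _ i)) *
      TExpr.eval g ginv e₂ x (fun i => idx (Fin.natAdd _ i))
  | _, .contr e => fun x idx =>
      ∑ ρ, ∑ σ, ginv x ρ σ * TExpr.eval g ginv e x (Fin.cons ρ (Fin.cons σ idx))
  | _, .permute π e => fun x idx => TExpr.eval g ginv e x (idx ∘ π)
  | _, .add e₁ e₂ => fun x idx => TExpr.eval g ginv e₁ x idx + TExpr.eval g ginv e₂ x idx
  | _, .smul c e => fun x idx => c * TExpr.eval g ginv e x idx

/-- `e.HasOrderDeg m d`: the invariant `e` is homogeneous of order `m` (number of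
covariant derivatives in each term) and degree `d` (number of Riemann factors in
each term). -/
inductive TExpr.HasOrderDeg {n : ℕ} : {q : ℕ} → TExpr n q → ℕ → ℕ → Prop where
  | metric : HasOrderDeg .metric 0 0
  | inv : HasOrderDeg .inv 0 0
  | riem : HasOrderDeg .riem 0 1
  | eps : HasOrderDeg .eps 0 0
  | cd {q : ℕ} {e : TExpr n q} {m d : ℕ} : HasOrderDeg e m d → HasOrderDeg e.cd (m + 1) d
  | tprod {q r : ℕ} {e₁ : TExpr n q} {e₂ : TExpr n r} {m₁ d₁ m₂ d₂ : ℕ} :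
      HasOrderDeg e₁ m₁ d₁ → HasOrderDeg e₂ m₂ d₂ →
      HasOrderDeg (e₁.tprod e₂) (m₁ + m₂) (d₁ + d₂)
  | contr {q : ℕ} {e : TExpr n (q + 2)} {m d : ℕ} : HasOrderDeg e m d → HasOrderDeg e.contr m d
  | permute {q : ℕ} {π : Equiv.Perm (Fin q)} {e : TExpr n q} {m d : ℕ} :
      HasOrderDeg e m d → HasOrderDeg (e.permute π) m d
  | add {q : ℕ} {e₁ e₂ : TExpr n q} {m d : ℕ} :
      HasOrderDeg e₁ m d → HasOrderDeg e₂ m d → HasOrderDeg (e₁.add e₂) m d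
  | smul {q : ℕ} {c : ℝ} {e : TExpr n q} {m d : ℕ} :
      HasOrderDeg e m d → HasOrderDeg (e.smul c) m d

/-- `P` is the parallel-transport operator along the curve `γ`. -/
def IsTransportAlong {n : ℕ} (g ginv : Pt n → Fin n → Fin n → ℝ)
    (γ : ℝ → Pt n) (P : ℝ → Fin n → Fin n → ℝ) : Prop :=
  (∀ μ ν, P 0 μ ν = if μ = ν then (1 : ℝ) else 0) ∧
  ∀ t μ ν, HasDerivAt (fun s => P s μ ν)
    (-∑ lam, ∑ ρ, christoffel g ginv (γ t) μ lam ρ * deriv (fun s => γ s lam) t * P t ρ ν) t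

/-- The subspace `W` of the tangent space at `p` is invariant under the holonomy
group of `(D, g)` at `p` (parallel transport around smooth loops in `D` based at `p`). -/
def HolonomyInvariantAt {n : ℕ} (g ginv : Pt n → Fin n → Fin n → ℝ) (D : Set (Pt n))
    (p : Pt n) (W : Submodule ℝ (Fin n → ℝ)) : Prop :=
  ∀ γ : ℝ → Pt n, ContDiff ℝ (⊤ : ℕ∞) γ → (∀ t, γ t ∈ D) → γ 0 = p → γ 1 = p →
    ∀ P, IsTransportAlong g ginv γ P →
      ∀ w ∈ W, (fun μ => ∑ ν, P 1 μ ν * w ν) ∈ W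

/-- The holonomy group of `(D,g)` at `p` is reducible: it leaves invariant a
non-trivial subspace of the tangent space. -/
def ReducibleAt {n : ℕ} (g ginv : Pt n → Fin n → Fin n → ℝ) (D : Set (Pt n))
    (p : Pt n) : Prop :=
  ∃ W : Submodule ℝ (Fin n → ℝ), W ≠ ⊥ ∧ W ≠ ⊤ ∧ HolonomyInvariantAt g ginv D p W

/-- The holonomy group of `(D,g)` at `p` is non-degenerately reducible: it leaves
invariant a non-trivial subspace on which `g` is non-degenerate. -/
def NonDegReducibleAt {n : ℕ} (g ginv : Pt n → Fin n → Fin n → ℝ) (D : Set (Pt n))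
    (p : Pt n) : Prop :=
  ∃ W : Submodule ℝ (Fin n → ℝ), W ≠ ⊥ ∧ W ≠ ⊤ ∧ HolonomyInvariantAt g ginv D p W ∧
    ∀ w ∈ W, (∀ u ∈ W, (∑ μ, ∑ ν, g p μ ν * w μ * u ν) = 0) → w = 0

section PartialDerivatives

variable {n : ℕ}

lemma pd_sub (i : Fin n) {f h : Pt n → ℝ} {x : Pt n} (hf : ContDiff ℝ (⊤ : ℕ∞) f)
    (hh : ContDiff ℝ (⊤ : ℕ∞) h) : pd i (fun y => f y - h y) x = pd i f x - pd i h x := by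
  unfold pd
  rw [fderiv_fun_sub (hf.differentiable (by simp) x) (hh.differentiable (by simp) x)]
  rfl

lemma pd_add (i : Fin n) {f h : Pt n → ℝ} {x : Pt n} (hf : ContDiff ℝ (⊤ : ℕ∞) f)
    (hh : ContDiff ℝ (⊤ : ℕ∞) h) : pd i (fun y => f y + h y) x = pd i f x + pd i h x := by
  unfold pd
  rw [fderiv_fun_add (hf.differentiable (by simp) x) (hh.differentiable (by simp) x)]
  rfl

lemma pd_mul (i : Fin n) {f h : Pt n → ℝ} {x : Pt n} (hf : ContDiff ℝ (⊤ : ℕ∞) f)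
    (hh : ContDiff ℝ (⊤ : ℕ∞) h) :
    pd i (fun y => f y * h y) x = pd i f x * h x + f x * pd i h x := by
  unfold pd
  rw [fderiv_fun_mul (hf.differentiable (by simp) x) (hh.differentiable (by simp) x)]
  simp only [add_apply, smul_apply, smul_eq_mul]
  ring

lemma pd_sum {ι : Type*} (s : Finset ι) (i : Fin n) {f : ι → Pt n → ℝ} {x : Pt n}
    (hf : ∀ j, ContDiff ℝ (⊤ : ℕ∞) (f j)) :
    pd i (fun y => ∑ j ∈ s, f j y) x = ∑ j ∈ s, pd i (f j) x := by
  unfold pd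
  rw [fderiv_fun_sum fun j _ => (hf j).differentiable (by simp) x]
  simp

lemma pd_const (i : Fin n) (c : ℝ) (x : Pt n) : pd i (fun _ => c) x = 0 := by
  simp [pd]

lemma contDiff_pd (i : Fin n) {f : Pt n → ℝ} (hf : ContDiff ℝ (⊤ : ℕ∞) f) :
    ContDiff ℝ (⊤ : ℕ∞) (pd i f) :=
  (hf.fderiv_right (m := (⊤ : ℕ∞)) (by simp)).clm_apply contDiff_const

lemma pd_comm (i j : Fin n) {f : Pt n → ℝ} (hf : ContDiff ℝ (⊤ : ℕ∞) f) (x : Pt n) :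
    pd i (pd j f) x = pd j (pd i f) x := by
  have key : ∀ a b : Fin n, pd a (pd b f) x =
      fderiv ℝ (fderiv ℝ f) x (Pi.single a 1) (Pi.single b 1) := by
    intro a b
    have hd : DifferentiableAt ℝ (fderiv ℝ f) x :=
      (hf.fderiv_right (m := (⊤ : ℕ∞)) (by simp)).differentiable (by simp) x
    change fderiv ℝ (fun y => fderiv ℝ f y (Pi.single b 1)) x (Pi.single a 1) = _
    rw [fderiv_clm_apply hd (differentiableAt_const _)]
    simp
  rw [key, key]
  have hs : IsSymmSndFDerivAt ℝ f x :=
    hf.contDiffAt.isSymmSndFDerivAt (by simpa using WithTop.coe_le_coe.2 (le_top : (2 : ℕ∞) ≤ ⊤))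
  exact hs.eq _ _

end PartialDerivatives

section Derivation

variable {n q : ℕ}

/-- The action of an endomorphism `M` on covariant tensors as a derivation:
`(M · U)_{α₁ … α_q} = ∑ᵢ M^ρ_{αᵢ} U_{α₁ … ρ … α_q}`. -/
def derivAct {n q : ℕ} : Matrix (Fin n) (Fin n) ℝ →ₗ[ℝ] ((Fin q → Fin n) → ℝ) →ₗ[ℝ]
    ((Fin q → Fin n) → ℝ) :=
  LinearMap.mk₂ ℝ (fun M U α => ∑ i, ∑ ρ, M ρ (α i) * U (Function.update α i ρ))
    (by intros; ext; simp [add_mul, Finset.sum_add_distrib])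
    (by intros; ext; simp [Finset.mul_sum, mul_assoc])
    (by intros; ext; simp [mul_add, Finset.sum_add_distrib])
    (by intros; ext; simp [Finset.mul_sum, mul_left_comm])

lemma derivAct_apply (M : Matrix (Fin n) (Fin n) ℝ) (U : (Fin q → Fin n) → ℝ)
    (α : Fin q → Fin n) :
    derivAct M U α = ∑ i, ∑ ρ, M ρ (α i) * U (Function.update α i ρ) := rfl

lemma derivAct_cons (M : Matrix (Fin n) (Fin n) ℝ) (U : (Fin (q + 1) → Fin n) → ℝ)
    (a : Fin n) (α : Fin q → Fin n) :
    derivAct M U (Fin.cons a α) = ∑ ρ, M ρ a * U (Fin.cons ρ α) +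
      derivAct M (fun β => U (Fin.cons a β)) α := by
  simp only [derivAct_apply, Fin.sum_univ_succ, Fin.cons_zero, Fin.cons_succ,
    Fin.update_cons_zero, Fin.cons_update]

lemma derivAct_derivAct (M N : Matrix (Fin n) (Fin n) ℝ) (U : (Fin q → Fin n) → ℝ)
    (α : Fin q → Fin n) :
    derivAct M (derivAct N U) α = derivAct (N * M) U α +
      ∑ i, ∑ j, if i = j then 0 else ∑ ρ, ∑ σ, M ρ (α i) * (N σ (α j) *
        U (Function.update (Function.update α i ρ) j σ)) := by
  simp only [derivAct_apply]
  rw [← Finset.sum_add_distrib]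
  refine Finset.sum_congr rfl fun i _ => ?_
  simp only [Finset.mul_sum]
  rw [Finset.sum_comm]
  rw [← Finset.add_sum_erase _ _ (Finset.mem_univ i)]
  rw [← Finset.add_sum_erase (a := i) (s := Finset.univ)
    (f := fun j => if i = j then (0 : ℝ) else _) (Finset.mem_univ i)]
  simp only [if_true, zero_add, Function.update_self, Function.update_idem]
  congr 1
  · rw [Finset.sum_comm]
    refine Finset.sum_congr rfl fun σ _ => ?_
    rw [Matrix.mul_apply, Finset.sum_mul]
    exact Finset.sum_congr rfl fun ρ _ => by ring
  · refine Finset.sum_congr rfl fun j hj => ?_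
    have hji : j ≠ i := Finset.ne_of_mem_erase hj
    simp only [if_neg hji.symm, Function.update_of_ne hji]

lemma derivAct_comm (M N : Matrix (Fin n) (Fin n) ℝ) (U : (Fin q → Fin n) → ℝ) :
    derivAct M (derivAct N U) - derivAct N (derivAct M U) = derivAct (N * M - M * N) U := by
  ext α
  have h : (∑ i, ∑ j, if i = j then 0 else ∑ ρ, ∑ σ, M ρ (α i) * (N σ (α j) *
        U (Function.update (Function.update α i ρ) j σ))) =
      ∑ i, ∑ j, if i = j then 0 else ∑ ρ, ∑ σ, N ρ (α i) * (M σ (α j) *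
        U (Function.update (Function.update α i ρ) j σ)) := by
    rw [Finset.sum_comm]
    refine Finset.sum_congr rfl fun i _ => Finset.sum_congr rfl fun j _ => ?_
    by_cases hij : i = j
    · simp [hij]
    · rw [if_neg hij, if_neg (Ne.symm hij), Finset.sum_comm]
      refine Finset.sum_congr rfl fun ρ _ => Finset.sum_congr rfl fun σ _ => ?_
      rw [Function.update_comm hij]
      ring
  rw [Pi.sub_apply, derivAct_derivAct, derivAct_derivAct, h, map_sub, LinearMap.sub_apply,
    Pi.sub_apply]
  ring

end Derivation

section CovariantDerivative

variable {n q : ℕ} {g ginv : Pt n → Fin n → Fin n → ℝ}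

/-- The Christoffel symbols `Γ^ρ_{λ a}` as a matrix in `(ρ, a)`. -/
def christoffelMatrix (g ginv : Pt n → Fin n → Fin n → ℝ) (lam : Fin n) (x : Pt n) :
    Matrix (Fin n) (Fin n) ℝ :=
  Matrix.of fun ρ a => christoffel g ginv x ρ lam a

/-- The components `R^ρ_{a λ μ}` as a matrix in `(ρ, a)`. -/
def riemannMatrix (g ginv : Pt n → Fin n → Fin n → ℝ) (lam μ : Fin n) (x : Pt n) :
    Matrix (Fin n) (Fin n) ℝ :=
  Matrix.of fun ρ a => riemannUp g ginv x ρ a lam μ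

/-- Covariant derivative of a covariant tensor field in a fixed coordinate direction. -/
def dirD (g ginv : Pt n → Fin n → Fin n → ℝ) (lam : Fin n) (U : Tensor n q) : Tensor n q :=
  fun x => (fun α => pd lam (fun y => U y α) x) - derivAct (christoffelMatrix g ginv lam x) (U x)

/-- Covariant derivative of an endomorphism field in a fixed coordinate direction. -/
def endD (g ginv : Pt n → Fin n → Fin n → ℝ) (lam : Fin n)
    (K : Pt n → Matrix (Fin n) (Fin n) ℝ) (x : Pt n) : Matrix (Fin n) (Fin n) ℝ :=
  Matrix.of (fun i j => pd lam (fun y => K y i j) x) +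
    christoffelMatrix g ginv lam x * K x - K x * christoffelMatrix g ginv lam x

/-- The components `∇_ν R^ρ_{a λ μ}` as a matrix in `(ρ, a)`. -/
def dRiemannMatrix (g ginv : Pt n → Fin n → Fin n → ℝ) (ν lam μ : Fin n) (x : Pt n) :
    Matrix (Fin n) (Fin n) ℝ :=
  endD g ginv ν (riemannMatrix g ginv lam μ) x -
    ∑ σ, christoffel g ginv x σ ν lam • riemannMatrix g ginv σ μ x -
    ∑ σ, christoffel g ginv x σ ν μ • riemannMatrix g ginv lam σ x

/-- The components `∇_τ ∇_ν R^ρ_{a λ μ}` as a matrix in `(ρ, a)`. -/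
def ddRiemannMatrix (g ginv : Pt n → Fin n → Fin n → ℝ) (τ ν lam μ : Fin n) (x : Pt n) :
    Matrix (Fin n) (Fin n) ℝ :=
  endD g ginv τ (dRiemannMatrix g ginv ν lam μ) x -
    ∑ σ, christoffel g ginv x σ τ ν • dRiemannMatrix g ginv σ lam μ x -
    ∑ σ, christoffel g ginv x σ τ lam • dRiemannMatrix g ginv ν σ μ x -
    ∑ σ, christoffel g ginv x σ τ μ • dRiemannMatrix g ginv ν lam σ x

lemma contDiff_christoffel (hg : IsMetric g ginv) (α β γ : Fin n) :
    ContDiff ℝ (⊤ : ℕ∞) fun x => christoffel g ginv x α β γ := by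
  unfold christoffel
  refine contDiff_const.mul (ContDiff.sum fun ρ _ => (hg.2.2.1 _ _).mul ?_)
  exact ((contDiff_pd _ (hg.2.1 _ _)).add (contDiff_pd _ (hg.2.1 _ _))).sub
    (contDiff_pd _ (hg.2.1 _ _))

lemma contDiff_riemannUp (hg : IsMetric g ginv) (α β γ δ : Fin n) :
    ContDiff ℝ (⊤ : ℕ∞) fun x => riemannUp g ginv x α β γ δ := by
  have h := contDiff_christoffel hg
  unfold riemannUp
  refine ((contDiff_pd _ (h _ _ _)).sub (contDiff_pd _ (h _ _ _))).add
    (ContDiff.sum fun ρ _ => ?_)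
  exact ((h _ _ _).mul (h _ _ _)).sub ((h _ _ _).mul (h _ _ _))

lemma contDiff_derivAct {K : Pt n → Matrix (Fin n) (Fin n) ℝ} {U : Tensor n q}
    (hK : ∀ i j, ContDiff ℝ (⊤ : ℕ∞) fun x => K x i j)
    (hU : ∀ α, ContDiff ℝ (⊤ : ℕ∞) fun x => U x α) (α : Fin q → Fin n) :
    ContDiff ℝ (⊤ : ℕ∞) fun x => derivAct (K x) (U x) α := by
  simp only [derivAct_apply]
  exact ContDiff.sum fun i _ => ContDiff.sum fun ρ _ => (hK _ _).mul (hU _)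

lemma contDiff_dirD (hg : IsMetric g ginv) {U : Tensor n q}
    (hU : ∀ α, ContDiff ℝ (⊤ : ℕ∞) fun x => U x α) (lam : Fin n) (α : Fin q → Fin n) :
    ContDiff ℝ (⊤ : ℕ∞) fun x => dirD g ginv lam U x α :=
  (contDiff_pd _ (hU α)).sub (contDiff_derivAct (fun _ _ => contDiff_christoffel hg _ _ _) hU α)

lemma contDiff_endD (hg : IsMetric g ginv) {K : Pt n → Matrix (Fin n) (Fin n) ℝ}
    (hK : ∀ i j, ContDiff ℝ (⊤ : ℕ∞) fun x => K x i j) (lam i j : Fin n) :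
    ContDiff ℝ (⊤ : ℕ∞) fun x => endD g ginv lam K x i j := by
  have h := contDiff_christoffel hg
  simp only [endD, Matrix.sub_apply, Matrix.add_apply, Matrix.mul_apply, christoffelMatrix,
    Matrix.of_apply]
  exact ((contDiff_pd _ (hK i j)).add (ContDiff.sum fun ρ _ => (h _ _ _).mul (hK _ _))).sub
    (ContDiff.sum fun ρ _ => (hK _ _).mul (h _ _ _))

lemma contDiff_dRiemannMatrix (hg : IsMetric g ginv) (ν lam μ i j : Fin n) :
    ContDiff ℝ (⊤ : ℕ∞) fun x => dRiemannMatrix g ginv ν lam μ x i j := by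
  have h := contDiff_christoffel hg
  have hR := contDiff_riemannUp hg
  simp only [dRiemannMatrix, Matrix.sub_apply, Matrix.sum_apply, Matrix.smul_apply, smul_eq_mul]
  exact ((contDiff_endD hg (fun _ _ => hR _ _ _ _) _ _ _).sub
    (ContDiff.sum fun σ _ => (h _ _ _).mul (hR _ _ _ _))).sub
    (ContDiff.sum fun σ _ => (h _ _ _).mul (hR _ _ _ _))

lemma christoffel_symm (hg : IsMetric g ginv) (x : Pt n) (α β γ : Fin n) :
    christoffel g ginv x α β γ = christoffel g ginv x α γ β := by
  have h : ∀ y, g y β γ = g y γ β := fun y => hg.1 y β γ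
  simp only [christoffel, h]
  congr 1
  exact Finset.sum_congr rfl fun ρ _ => by ring

lemma covD_cons (U : Tensor n q) (x : Pt n) (lam : Fin n) (α : Fin q → Fin n) :
    covD g ginv U x (Fin.cons lam α) = dirD g ginv lam U x α := by
  simp only [covD, dirD, Fin.cons_zero, Fin.cons_succ, Pi.sub_apply, derivAct_apply]
  rfl

lemma contDiff_covD (hg : IsMetric g ginv) {U : Tensor n q}
    (hU : ∀ α, ContDiff ℝ (⊤ : ℕ∞) fun x => U x α) (α : Fin (q + 1) → Fin n) :
    ContDiff ℝ (⊤ : ℕ∞) fun x => covD g ginv U x α := by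
  rw [← Fin.cons_self_tail α]
  simp only [covD_cons]
  exact contDiff_dirD hg hU _ _

lemma dirD_cons (U : Tensor n (q + 1)) (x : Pt n) (lam a : Fin n) (α : Fin q → Fin n) :
    dirD g ginv lam U x (Fin.cons a α) =
      dirD g ginv lam (fun y β => U y (Fin.cons a β)) x α -
        ∑ ρ, christoffel g ginv x ρ lam a * U x (Fin.cons ρ α) := by
  simp only [dirD, Pi.sub_apply, derivAct_cons, christoffelMatrix, Matrix.of_apply]
  ring

lemma covD_covD_cons (U : Tensor n q) (x : Pt n) (lam μ : Fin n) (α : Fin q → Fin n) :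
    covD g ginv (covD g ginv U) x (Fin.cons lam (Fin.cons μ α)) =
      dirD g ginv lam (dirD g ginv μ U) x α -
        ∑ ρ, christoffel g ginv x ρ lam μ * dirD g ginv ρ U x α := by
  simp only [covD_cons, dirD_cons]

lemma dirD_derivAct {K : Pt n → Matrix (Fin n) (Fin n) ℝ} {U : Tensor n q}
    (hK : ∀ i j, ContDiff ℝ (⊤ : ℕ∞) fun x => K x i j)
    (hU : ∀ α, ContDiff ℝ (⊤ : ℕ∞) fun x => U x α) (lam : Fin n) (x : Pt n) :
    dirD g ginv lam (fun y => derivAct (K y) (U y)) x =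
      derivAct (endD g ginv lam K x) (U x) + derivAct (K x) (dirD g ginv lam U x) := by
  have h1 : (fun α => pd lam (fun y => derivAct (K y) (U y) α) x) =
      derivAct (Matrix.of (fun i j => pd lam (fun y => K y i j) x)) (U x) +
        derivAct (K x) (fun α => pd lam (fun y => U y α) x) := by
    ext α
    simp only [derivAct_apply, Pi.add_apply, ← Finset.sum_add_distrib, Matrix.of_apply]
    rw [pd_sum _ _ fun i => ContDiff.sum fun ρ _ => (hK _ _).mul (hU _)]
    refine Finset.sum_congr rfl fun i _ => ?_
    rw [pd_sum _ _ fun ρ => (hK _ _).mul (hU _)]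
    exact Finset.sum_congr rfl fun ρ _ => pd_mul _ (hK _ _) (hU _)
  have h2 := derivAct_comm (K x) (christoffelMatrix g ginv lam x) (U x)
  simp only [dirD, endD, h1, map_sub, map_add, LinearMap.sub_apply, LinearMap.add_apply] at h2 ⊢
  linear_combination h2

lemma dirD_sub (lam : Fin n) {U W : Tensor n q} (hU : ∀ α, ContDiff ℝ (⊤ : ℕ∞) fun x => U x α)
    (hW : ∀ α, ContDiff ℝ (⊤ : ℕ∞) fun x => W x α) (x : Pt n) :
    dirD g ginv lam (fun y => U y - W y) x = dirD g ginv lam U x - dirD g ginv lam W x := by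
  ext α
  simp only [dirD, Pi.sub_apply, map_sub, pd_sub lam (hU α) (hW α)]
  ring

lemma dirD_add (lam : Fin n) {U W : Tensor n q} (hU : ∀ α, ContDiff ℝ (⊤ : ℕ∞) fun x => U x α)
    (hW : ∀ α, ContDiff ℝ (⊤ : ℕ∞) fun x => W x α) (x : Pt n) :
    dirD g ginv lam (fun y => U y + W y) x = dirD g ginv lam U x + dirD g ginv lam W x := by
  ext α
  simp only [dirD, Pi.sub_apply, Pi.add_apply, map_add, pd_add lam (hU α) (hW α)]
  ring

lemma dirD_zero (lam : Fin n) (x : Pt n) : dirD g ginv lam (0 : Tensor n q) x = 0 := by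
  ext α
  simp [dirD, pd_const]

lemma riemannMatrix_eq (lam μ : Fin n) (x : Pt n) :
    riemannMatrix g ginv lam μ x =
      Matrix.of (fun i j => pd lam (fun y => christoffelMatrix g ginv μ y i j) x) -
      Matrix.of (fun i j => pd μ (fun y => christoffelMatrix g ginv lam y i j) x) +
      (christoffelMatrix g ginv lam x * christoffelMatrix g ginv μ x -
        christoffelMatrix g ginv μ x * christoffelMatrix g ginv lam x) := by
  ext i j
  simp [riemannMatrix, riemannUp, christoffelMatrix, Matrix.mul_apply]

/-- The Ricci identity. -/
lemma dirD_comm (hg : IsMetric g ginv) {U : Tensor n q}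
    (hU : ∀ α, ContDiff ℝ (⊤ : ℕ∞) fun x => U x α) (lam μ : Fin n) (x : Pt n) :
    dirD g ginv lam (dirD g ginv μ U) x - dirD g ginv μ (dirD g ginv lam U) x =
      -derivAct (riemannMatrix g ginv lam μ x) (U x) := by
  have key : ∀ a b : Fin n, dirD g ginv a (dirD g ginv b U) x =
      (fun α => pd a (pd b (fun y => U y α)) x) -
        derivAct (christoffelMatrix g ginv a x) (fun α => pd b (fun y => U y α) x) -
        (derivAct (endD g ginv a (christoffelMatrix g ginv b) x) (U x) +
          derivAct (christoffelMatrix g ginv b x) (dirD g ginv a U x)) := by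
    intro a b
    have hΓ : ∀ i j, ContDiff ℝ (⊤ : ℕ∞) fun x => christoffelMatrix g ginv b x i j :=
      fun i j => contDiff_christoffel hg _ _ _
    rw [← dirD_derivAct hΓ hU]
    exact dirD_sub a (fun α => contDiff_pd b (hU α)) (contDiff_derivAct hΓ hU) x
  have hs : (fun α => pd lam (pd μ (fun y => U y α)) x) =
      fun α => pd μ (pd lam (fun y => U y α)) x := by
    ext α; exact pd_comm _ _ (hU α) x
  have hc := derivAct_comm (christoffelMatrix g ginv lam x) (christoffelMatrix g ginv μ x) (U x)
  rw [key, key, hs, riemannMatrix_eq]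
  simp only [dirD, endD, map_sub, map_add, LinearMap.sub_apply, LinearMap.add_apply] at hc ⊢
  linear_combination -hc

end CovariantDerivative

section SecondOrderParallel

variable {n q : ℕ} {g ginv : Pt n → Fin n → Fin n → ℝ}

lemma dirD_dirD_eq {U : Tensor n q} (hpar : ∀ x idx, covD g ginv (covD g ginv U) x idx = 0)
    (lam μ : Fin n) (x : Pt n) :
    dirD g ginv lam (dirD g ginv μ U) x =
      ∑ ρ, christoffel g ginv x ρ lam μ • dirD g ginv ρ U x := by
  ext α
  have h := hpar x (Fin.cons lam (Fin.cons μ α))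
  rw [covD_covD_cons] at h
  rw [Finset.sum_apply]
  simp only [Pi.smul_apply, smul_eq_mul]
  linarith

lemma derivAct_riemannMatrix_eq_zero (hg : IsMetric g ginv) {U : Tensor n q}
    (hU : ∀ α, ContDiff ℝ (⊤ : ℕ∞) fun x => U x α)
    (hpar : ∀ x idx, covD g ginv (covD g ginv U) x idx = 0) (lam μ : Fin n) (x : Pt n) :
    derivAct (riemannMatrix g ginv lam μ x) (U x) = 0 := by
  have h := dirD_comm hg hU lam μ x
  rw [dirD_dirD_eq hpar, dirD_dirD_eq hpar] at h
  simp only [christoffel_symm hg x _ lam μ, sub_self] at h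
  exact neg_eq_zero.1 h.symm

lemma derivAct_dRiemannMatrix_add (hg : IsMetric g ginv) {U : Tensor n q}
    (hU : ∀ α, ContDiff ℝ (⊤ : ℕ∞) fun x => U x α)
    (hpar : ∀ x idx, covD g ginv (covD g ginv U) x idx = 0) (ν lam μ : Fin n) (x : Pt n) :
    derivAct (dRiemannMatrix g ginv ν lam μ x) (U x) +
      derivAct (riemannMatrix g ginv lam μ x) (dirD g ginv ν U x) = 0 := by
  have h0 := derivAct_riemannMatrix_eq_zero hg hU hpar
  have h := dirD_derivAct (g := g) (ginv := ginv) (K := riemannMatrix g ginv lam μ)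
    (fun _ _ => contDiff_riemannUp hg _ _ _ _) hU ν x
  have hz : (fun y => derivAct (riemannMatrix g ginv lam μ y) (U y)) = (0 : Tensor n q) :=
    funext (h0 lam μ)
  rw [hz, dirD_zero] at h
  simp only [dRiemannMatrix, map_sub, map_sum, map_smul, LinearMap.sub_apply,
    LinearMap.sum_apply, LinearMap.smul_apply, h0, smul_zero, Finset.sum_const_zero, sub_zero]
  exact h.symm

lemma derivAct_dRiemannMatrix_dirD (hg : IsMetric g ginv)
    (hdd : ∀ τ ν lam μ x, ddRiemannMatrix g ginv τ ν lam μ x = 0) {U : Tensor n q}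
    (hU : ∀ α, ContDiff ℝ (⊤ : ℕ∞) fun x => U x α)
    (hpar : ∀ x idx, covD g ginv (covD g ginv U) x idx = 0) (τ ν lam μ : Fin n) (x : Pt n) :
    derivAct (dRiemannMatrix g ginv ν lam μ x) (dirD g ginv τ U x) +
      derivAct (dRiemannMatrix g ginv τ lam μ x) (dirD g ginv ν U x) = 0 := by
  have h1 := derivAct_dRiemannMatrix_add hg hU hpar
  have hR : ∀ i j, ContDiff ℝ (⊤ : ℕ∞) fun x => riemannMatrix g ginv lam μ x i j :=
    fun _ _ => contDiff_riemannUp hg _ _ _ _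
  have hdR := contDiff_dRiemannMatrix hg ν lam μ
  have hV := contDiff_dirD hg hU ν
  have hz : (fun y => derivAct (dRiemannMatrix g ginv ν lam μ y) (U y) +
      derivAct (riemannMatrix g ginv lam μ y) (dirD g ginv ν U y)) = (0 : Tensor n q) :=
    funext (h1 ν lam μ)
  have h := dirD_zero (g := g) (ginv := ginv) (q := q) τ x
  rw [← hz, dirD_add τ (contDiff_derivAct hdR hU) (contDiff_derivAct hR hV),
    dirD_derivAct hdR hU, dirD_derivAct hR hV, dirD_dirD_eq hpar] at h
  have e1 : endD g ginv τ (dRiemannMatrix g ginv ν lam μ) x =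
      ∑ σ, christoffel g ginv x σ τ ν • dRiemannMatrix g ginv σ lam μ x +
      ∑ σ, christoffel g ginv x σ τ lam • dRiemannMatrix g ginv ν σ μ x +
      ∑ σ, christoffel g ginv x σ τ μ • dRiemannMatrix g ginv ν lam σ x := by
    have := hdd τ ν lam μ x
    unfold ddRiemannMatrix at this
    rw [← sub_eq_zero, ← this]
    abel
  have e2 : endD g ginv τ (riemannMatrix g ginv lam μ) x = dRiemannMatrix g ginv τ lam μ x +
      ∑ σ, christoffel g ginv x σ τ lam • riemannMatrix g ginv σ μ x +
      ∑ σ, christoffel g ginv x σ τ μ • riemannMatrix g ginv lam σ x := by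
    unfold dRiemannMatrix
    abel
  have s1 : ∑ σ, christoffel g ginv x σ τ ν •
      (derivAct (dRiemannMatrix g ginv σ lam μ x) (U x) +
      derivAct (riemannMatrix g ginv lam μ x) (dirD g ginv σ U x)) = 0 := by simp [h1]
  have s2 : ∑ σ, christoffel g ginv x σ τ lam •
      (derivAct (dRiemannMatrix g ginv ν σ μ x) (U x) +
      derivAct (riemannMatrix g ginv σ μ x) (dirD g ginv ν U x)) = 0 := by simp [h1]
  have s3 : ∑ σ, christoffel g ginv x σ τ μ •
      (derivAct (dRiemannMatrix g ginv ν lam σ x) (U x) +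
      derivAct (riemannMatrix g ginv lam σ x) (dirD g ginv ν U x)) = 0 := by simp [h1]
  simp only [e1, e2, map_add, map_sum, map_smul, LinearMap.add_apply, LinearMap.sum_apply,
    LinearMap.smul_apply] at h
  simp only [smul_add, Finset.sum_add_distrib] at s1 s2 s3
  linear_combination h - s1 - s2 - s3

lemma sum_dRiemannMatrix_add_mul_dirD (hg : IsMetric g ginv)
    (hdd : ∀ τ ν lam μ x, ddRiemannMatrix g ginv τ ν lam μ x = 0) {U : Tensor n q}
    (hU : ∀ α, ContDiff ℝ (⊤ : ℕ∞) fun x => U x α)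
    (hpar : ∀ x idx, covD g ginv (covD g ginv U) x idx = 0) (τ ν lam μ : Fin n) (x : Pt n)
    (α : Fin q → Fin n) :
    ∑ ρ, (dRiemannMatrix g ginv τ lam μ x ρ ν + dRiemannMatrix g ginv ν lam μ x ρ τ) *
      dirD g ginv ρ U x α = 0 := by
  have hz : covD g ginv (covD g ginv U) = 0 := by
    funext x idx; exact hpar x idx
  have hpar' : ∀ x idx, covD g ginv (covD g ginv (covD g ginv U)) x idx = 0 := by
    intro x idx
    rw [hz, ← Fin.cons_self_tail idx, covD_cons, dirD_zero]
    rfl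
  have hd : ∀ ν x, dirD g ginv ν (covD g ginv U) x = 0 := by
    intro ν x
    ext idx
    rw [← covD_cons, hz]
    rfl
  have key : ∀ τ ν, ∑ ρ, dRiemannMatrix g ginv τ lam μ x ρ ν * dirD g ginv ρ U x α +
      derivAct (dRiemannMatrix g ginv τ lam μ x) (dirD g ginv ν U x) α = 0 := by
    intro τ ν
    have h := derivAct_dRiemannMatrix_add hg (contDiff_covD hg hU) hpar' τ lam μ x
    rw [hd, map_zero, add_zero] at h
    have h := congrFun h (Fin.cons ν α)
    rw [derivAct_cons] at h
    simp only [covD_cons] at h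
    exact h
  have h := congrFun (derivAct_dRiemannMatrix_dirD hg hdd hU hpar τ ν lam μ x) α
  simp only [Pi.add_apply, Pi.zero_apply] at h
  simp only [add_mul, Finset.sum_add_distrib]
  linarith [key τ ν, key ν τ]

end SecondOrderParallel

section CurvatureSymmetries

variable {n : ℕ} {g ginv : Pt n → Fin n → Fin n → ℝ}

lemma sum_metric_mul_inv (hg : IsMetric g ginv) (x : Pt n) (μ ν : Fin n) :
    ∑ ρ, g x μ ρ * ginv x ρ ν = if μ = ν then (1 : ℝ) else 0 := by
  have h : Matrix.of (ginv x) * Matrix.of (g x) = 1 := by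
    ext i j
    simp [Matrix.mul_apply, hg.2.2.2 x i j, Matrix.one_apply]
  have h' := congrArg (fun M => M μ ν) (mul_eq_one_comm.1 h)
  simpa [Matrix.mul_apply, Matrix.one_apply] using h'

lemma sum_metric_mul_sum_inv (hg : IsMetric g ginv) (x : Pt n) (v : Fin n → ℝ) (a : Fin n) :
    ∑ ρ, g x a ρ * ∑ σ, ginv x ρ σ * v σ = v a := by
  simp only [Finset.mul_sum, ← mul_assoc]
  rw [Finset.sum_comm]
  simp [← Finset.sum_mul, sum_metric_mul_inv hg]

lemma sum_inv_mul_sum_metric (hg : IsMetric g ginv) (x : Pt n) (v : Fin n → ℝ) (a : Fin n) :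
    ∑ ρ, ginv x a ρ * ∑ σ, g x ρ σ * v σ = v a := by
  simp only [Finset.mul_sum, ← mul_assoc]
  rw [Finset.sum_comm]
  simp [← Finset.sum_mul, hg.2.2.2]

lemma inv_symm (hg : IsMetric g ginv) (x : Pt n) (a b : Fin n) : ginv x a b = ginv x b a := by
  have h : Matrix.of (ginv x) * Matrix.of (g x) = 1 := by
    ext i j
    simp [Matrix.mul_apply, hg.2.2.2 x i j, Matrix.one_apply]
  have hgT : (Matrix.of (g x)).transpose = Matrix.of (g x) := by
    ext i j; exact hg.1 x j i
  have h' : Matrix.of (g x) * (Matrix.of (ginv x)).transpose = 1 := by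
    rw [← Matrix.transpose_one, ← h, Matrix.transpose_mul, hgT]
  exact congrArg (fun M => M a b) (left_inv_eq_right_inv h h')

lemma sum_metric_mul_christoffel (hg : IsMetric g ginv) (x : Pt n) (a β γ : Fin n) :
    ∑ ρ, g x a ρ * christoffel g ginv x ρ β γ =
      (1 / 2) * (pd β (fun y => g y a γ) x + pd γ (fun y => g y a β) x -
        pd a (fun y => g y β γ) x) := by
  rw [← sum_metric_mul_sum_inv hg x (fun a => pd β (fun y => g y a γ) x +
    pd γ (fun y => g y a β) x - pd a (fun y => g y β γ) x) a, Finset.mul_sum]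
  exact Finset.sum_congr rfl fun ρ _ => by rw [christoffel]; ring

/-- Metric compatibility of the Levi-Civita connection. -/
lemma pd_metric (hg : IsMetric g ginv) (x : Pt n) (ν a b : Fin n) :
    pd ν (fun y => g y a b) x = ∑ σ, christoffel g ginv x σ ν a * g x σ b +
      ∑ σ, christoffel g ginv x σ ν b * g x a σ := by
  have h1 := sum_metric_mul_christoffel hg x b ν a
  have h2 := sum_metric_mul_christoffel hg x a ν b
  have e : ∀ i j k, pd i (fun y => g y j k) x = pd i (fun y => g y k j) x := fun i j k => by
    simp only [hg.1 _ j k]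
  simp only [hg.1 x _ b, mul_comm (christoffel g ginv x _ _ _), h1, h2]
  rw [e ν b a, e a b ν, e b a ν]
  ring

lemma dirD_rank_zero (U : Tensor n 0) (x : Pt n) (lam : Fin n) (α : Fin 0 → Fin n) :
    dirD g ginv lam U x α = pd lam (fun y => U y α) x := by
  simp [dirD, derivAct_apply]

lemma dirD_metric (hg : IsMetric g ginv) (lam : Fin n) (x : Pt n) :
    dirD g ginv lam (fun y (idx : Fin 2 → Fin n) => g y (idx 0) (idx 1)) x = 0 := by
  ext idx
  rw [← Fin.cons_self_tail idx, dirD_cons, ← Fin.cons_self_tail (Fin.tail idx), dirD_cons,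
    dirD_rank_zero]
  have h := pd_metric hg x lam (idx 0) (idx 1)
  change pd lam (fun y => g y (idx 0) (idx 1)) x -
    ∑ ρ, christoffel g ginv x ρ lam (idx 1) * g x (idx 0) ρ -
    ∑ ρ, christoffel g ginv x ρ lam (idx 0) * g x ρ (idx 1) = 0
  linarith

lemma sum_metric_mul_dRiemannMatrix_antisymm (hg : IsMetric g ginv) (ν c d a b : Fin n)
    (x : Pt n) : ∑ ρ, g x a ρ * dRiemannMatrix g ginv ν c d x ρ b =
      -∑ ρ, g x b ρ * dRiemannMatrix g ginv ν c d x ρ a := by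
  have hz : covD g ginv (fun y (idx : Fin 2 → Fin n) => g y (idx 0) (idx 1)) = 0 := by
    funext x idx
    rw [← Fin.cons_self_tail idx, covD_cons, dirD_metric hg]
    rfl
  have h := derivAct_dRiemannMatrix_add hg
    (U := fun y (idx : Fin 2 → Fin n) => g y (idx 0) (idx 1)) (fun _ => hg.2.1 _ _)
    (by
      intro x idx
      rw [hz, ← Fin.cons_self_tail idx, covD_cons, dirD_zero]
      rfl) ν c d x
  rw [dirD_metric hg, map_zero, add_zero] at h
  have h := congrFun h ![a, b]
  simp only [derivAct_apply, Fin.sum_univ_two] at h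
  simp at h
  rw [eq_neg_iff_add_eq_zero, ← h, add_comm]
  congr 1
  · exact Finset.sum_congr rfl fun ρ _ => by rw [hg.1 x b ρ]; ring
  · exact Finset.sum_congr rfl fun ρ _ => by ring

lemma riemannUp_antisymm (x : Pt n) (ρ b c d : Fin n) :
    riemannUp g ginv x ρ b c d = -riemannUp g ginv x ρ b d c := by
  simp only [riemannUp, Finset.sum_sub_distrib]
  ring

/-- The first Bianchi identity. -/
lemma riemannUp_cyclic (hg : IsMetric g ginv) (x : Pt n) (ρ b c d : Fin n) :
    riemannUp g ginv x ρ b c d + riemannUp g ginv x ρ c d b + riemannUp g ginv x ρ d b c = 0 := by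
  simp only [riemannUp, Finset.sum_sub_distrib, christoffel_symm hg _ _ c b,
    christoffel_symm hg _ _ d b, christoffel_symm hg _ _ d c]
  ring

lemma dRiemannMatrix_apply (ν c d ρ b : Fin n) (x : Pt n) :
    dRiemannMatrix g ginv ν c d x ρ b =
      pd ν (fun y => riemannUp g ginv y ρ b c d) x +
      ∑ σ, christoffel g ginv x ρ ν σ * riemannUp g ginv x σ b c d -
      ∑ σ, christoffel g ginv x σ ν b * riemannUp g ginv x ρ σ c d -
      ∑ σ, christoffel g ginv x σ ν c * riemannUp g ginv x ρ b σ d -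
      ∑ σ, christoffel g ginv x σ ν d * riemannUp g ginv x ρ b c σ := by
  simp [dRiemannMatrix, endD, riemannMatrix, christoffelMatrix, Matrix.mul_apply,
    Matrix.sum_apply, mul_comm]

lemma ddRiemannMatrix_apply (τ ν c d ρ b : Fin n) (x : Pt n) :
    ddRiemannMatrix g ginv τ ν c d x ρ b =
      pd τ (fun y => dRiemannMatrix g ginv ν c d y ρ b) x +
      ∑ σ, christoffel g ginv x ρ τ σ * dRiemannMatrix g ginv ν c d x σ b -
      ∑ σ, christoffel g ginv x σ τ b * dRiemannMatrix g ginv ν c d x ρ σ -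
      ∑ σ, christoffel g ginv x σ τ ν * dRiemannMatrix g ginv σ c d x ρ b -
      ∑ σ, christoffel g ginv x σ τ c * dRiemannMatrix g ginv ν σ d x ρ b -
      ∑ σ, christoffel g ginv x σ τ d * dRiemannMatrix g ginv ν c σ x ρ b := by
  simp [ddRiemannMatrix, endD, christoffelMatrix, Matrix.mul_apply, Matrix.sum_apply, mul_comm]

lemma pd_neg_of_eq (i : Fin n) {f h : Pt n → ℝ} (hf : ∀ y, f y = -h y) (x : Pt n) :
    pd i f x = -pd i h x := by
  have : f = fun y => -h y := funext hf
  simp [this, pd]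

lemma dRiemannMatrix_antisymm (ν c d ρ b : Fin n) (x : Pt n) :
    dRiemannMatrix g ginv ν c d x ρ b = -dRiemannMatrix g ginv ν d c x ρ b := by
  rw [dRiemannMatrix_apply, dRiemannMatrix_apply,
    pd_neg_of_eq ν (fun y => riemannUp_antisymm y ρ b c d)]
  simp only [fun σ b => riemannUp_antisymm (g := g) (ginv := ginv) x σ b c d,
    fun σ => riemannUp_antisymm (g := g) (ginv := ginv) x ρ b σ d,
    fun σ => riemannUp_antisymm (g := g) (ginv := ginv) x ρ b c σ, mul_neg,
    Finset.sum_neg_distrib]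
  ring

lemma dRiemannMatrix_cyclic (hg : IsMetric g ginv) (ν c d ρ b : Fin n) (x : Pt n) :
    dRiemannMatrix g ginv ν c d x ρ b + dRiemannMatrix g ginv ν d b x ρ c +
      dRiemannMatrix g ginv ν b c x ρ d = 0 := by
  have hR := contDiff_riemannUp hg
  have hc := riemannUp_cyclic hg
  have h0 : pd ν (fun y => riemannUp g ginv y ρ b c d) x +
      pd ν (fun y => riemannUp g ginv y ρ c d b) x +
      pd ν (fun y => riemannUp g ginv y ρ d b c) x = 0 := by
    rw [← pd_add _ (hR _ _ _ _) (hR _ _ _ _),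
      ← pd_add _ ((hR _ _ _ _).add (hR _ _ _ _)) (hR _ _ _ _)]
    simp only [hc, pd_const]
  have hs : ∀ (w : Fin n → ℝ) (r b c d : Fin n → Fin n),
      ∑ σ, w σ * riemannUp g ginv x (r σ) (b σ) (c σ) (d σ) +
      ∑ σ, w σ * riemannUp g ginv x (r σ) (c σ) (d σ) (b σ) +
      ∑ σ, w σ * riemannUp g ginv x (r σ) (d σ) (b σ) (c σ) = 0 := by
    intro w r b c d
    simp only [← Finset.sum_add_distrib, ← mul_add, hc, mul_zero, Finset.sum_const_zero]
  rw [dRiemannMatrix_apply, dRiemannMatrix_apply, dRiemannMatrix_apply]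
  have h1 := hs (fun σ => christoffel g ginv x ρ ν σ) id (fun _ => b) (fun _ => c) (fun _ => d)
  have h2 := hs (fun σ => christoffel g ginv x σ ν b) (fun _ => ρ) id (fun _ => c) (fun _ => d)
  have h3 := hs (fun σ => christoffel g ginv x σ ν c) (fun _ => ρ) (fun _ => b) id (fun _ => d)
  have h4 := hs (fun σ => christoffel g ginv x σ ν d) (fun _ => ρ) (fun _ => b) (fun _ => c) id
  simp only [id] at h1 h2 h3 h4
  linarith

/-- The second Bianchi identity. -/
lemma dRiemannMatrix_cyclic_deriv (hg : IsMetric g ginv) (ν c d : Fin n) (x : Pt n) :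
    dRiemannMatrix g ginv ν c d x + dRiemannMatrix g ginv c d ν x +
      dRiemannMatrix g ginv d ν c x = 0 := by
  have hΓ := contDiff_christoffel hg
  have he : ∀ ν c d, endD g ginv ν (riemannMatrix g ginv c d) x =
      Matrix.of (fun i j => pd ν (pd c (fun y => christoffelMatrix g ginv d y i j)) x) -
      Matrix.of (fun i j => pd ν (pd d (fun y => christoffelMatrix g ginv c y i j)) x) +
      ((Matrix.of fun i j => pd ν (fun y => christoffelMatrix g ginv c y i j) x) *
          christoffelMatrix g ginv d x +
        christoffelMatrix g ginv c x *
          (Matrix.of fun i j => pd ν (fun y => christoffelMatrix g ginv d y i j) x) -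
        ((Matrix.of fun i j => pd ν (fun y => christoffelMatrix g ginv d y i j) x) *
          christoffelMatrix g ginv c x +
        christoffelMatrix g ginv d x *
          (Matrix.of fun i j => pd ν (fun y => christoffelMatrix g ginv c y i j) x))) +
      christoffelMatrix g ginv ν x * riemannMatrix g ginv c d x -
      riemannMatrix g ginv c d x * christoffelMatrix g ginv ν x := by
    intro ν c d
    unfold endD
    congr 2
    ext i j
    have hprod : ∀ ρ (a b : Fin n), ContDiff ℝ (⊤ : ℕ∞) fun y =>
        christoffel g ginv y i a ρ * christoffel g ginv y ρ b j :=
      fun ρ a b => (hΓ _ _ _).mul (hΓ _ _ _)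
    simp only [riemannMatrix, riemannUp, Matrix.of_apply, Matrix.add_apply, Matrix.sub_apply,
      Matrix.mul_apply, christoffelMatrix]
    rw [pd_add _ ((contDiff_pd _ (hΓ _ _ _)).sub (contDiff_pd _ (hΓ _ _ _)))
      (ContDiff.sum fun ρ _ => (hprod ρ c d).sub (hprod ρ d c)),
      pd_sub _ (contDiff_pd _ (hΓ _ _ _)) (contDiff_pd _ (hΓ _ _ _)),
      pd_sum _ _ fun ρ => (hprod ρ c d).sub (hprod ρ d c)]
    congr 1
    simp only [← Finset.sum_add_distrib, ← Finset.sum_sub_distrib]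
    refine Finset.sum_congr rfl fun ρ _ => ?_
    rw [pd_sub _ (hprod ρ c d) (hprod ρ d c), pd_mul _ (hΓ _ _ _) (hΓ _ _ _),
      pd_mul _ (hΓ _ _ _) (hΓ _ _ _)]
  have hend : endD g ginv ν (riemannMatrix g ginv c d) x +
      endD g ginv c (riemannMatrix g ginv d ν) x +
      endD g ginv d (riemannMatrix g ginv ν c) x = 0 := by
    have hp : ∀ a b k, Matrix.of
        (fun i j => pd a (pd b (fun y => christoffelMatrix g ginv k y i j)) x) =
        Matrix.of (fun i j => pd b (pd a (fun y => christoffelMatrix g ginv k y i j)) x) := by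
      intro a b k
      ext i j
      exact pd_comm a b (hΓ _ _ _) x
    simp only [he, riemannMatrix_eq]
    rw [hp c ν d, hp d c ν, hp d ν c]
    noncomm_ring
  have ha : ∀ a b, riemannMatrix g ginv a b x = -riemannMatrix g ginv b a x := by
    intro a b
    ext i j
    exact riemannUp_antisymm x i j a b
  have hn : ∀ a b c, ∑ σ, christoffel g ginv x σ a b • riemannMatrix g ginv c σ x =
      -∑ σ, christoffel g ginv x σ a b • riemannMatrix g ginv σ c x := by
    intro a b c
    simp only [ha c, smul_neg, Finset.sum_neg_distrib]
  simp only [dRiemannMatrix, hn, christoffel_symm hg x _ c ν, christoffel_symm hg x _ d ν,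
    christoffel_symm hg x _ d c]
  rw [← hend]
  abel

end CurvatureSymmetries

section Contractions

variable {n : ℕ} {g ginv : Pt n → Fin n → Fin n → ℝ}

/-- Covariant differentiation commutes with lowering an index. -/
lemma pd_sum_metric_mul (hg : IsMetric g ginv) {V : Pt n → Fin n → ℝ}
    (hV : ∀ ρ, ContDiff ℝ (⊤ : ℕ∞) fun x => V x ρ) (ν a : Fin n) (x : Pt n) :
    pd ν (fun y => ∑ ρ, g y a ρ * V y ρ) x -
      ∑ σ, christoffel g ginv x σ ν a * ∑ ρ, g x σ ρ * V x ρ =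
    ∑ ρ, g x a ρ * (pd ν (fun y => V y ρ) x + ∑ σ, christoffel g ginv x ρ ν σ * V x σ) := by
  rw [pd_sum _ _ fun ρ => (hg.2.1 a ρ).mul (hV ρ)]
  simp only [pd_mul ν (hg.2.1 _ _) (hV _), pd_metric hg, add_mul, mul_add,
    Finset.sum_add_distrib, Finset.mul_sum, Finset.sum_mul]
  have e1 : ∑ σ, ∑ ρ, christoffel g ginv x σ ν a * (g x σ ρ * V x ρ) =
      ∑ ρ, ∑ σ, christoffel g ginv x σ ν a * g x σ ρ * V x ρ := by
    rw [Finset.sum_comm]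
    exact Finset.sum_congr rfl fun _ _ => Finset.sum_congr rfl fun _ _ => by ring
  have e2 : ∑ ρ, ∑ σ, g x a ρ * (christoffel g ginv x ρ ν σ * V x σ) =
      ∑ ρ, ∑ σ, christoffel g ginv x σ ν ρ * g x a σ * V x ρ := by
    rw [Finset.sum_comm]
    exact Finset.sum_congr rfl fun _ _ => Finset.sum_congr rfl fun _ _ => by ring
  rw [e1, e2]
  ring

lemma sum_mul_sum_metric_mul (w m : Fin n → ℝ) (X : Fin n → Fin n → ℝ) :
    ∑ σ, w σ * ∑ ρ, m ρ * X σ ρ = ∑ ρ, m ρ * ∑ σ, w σ * X σ ρ := by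
  simp only [Finset.mul_sum]
  rw [Finset.sum_comm]
  exact Finset.sum_congr rfl fun _ _ => Finset.sum_congr rfl fun _ _ => by ring

lemma riemann_vec (x : Pt n) (a b c d : Fin n) : riemann g ginv x ![a, b, c, d] =
    ∑ ρ, g x a ρ * riemannUp g ginv x ρ b c d := rfl

lemma covD_rank_two (U : Tensor n 2) (x : Pt n) (ν a b : Fin n) :
    covD g ginv U x ![ν, a, b] = pd ν (fun y => U y ![a, b]) x -
      ∑ σ, christoffel g ginv x σ ν b * U x ![a, σ] -
      ∑ σ, christoffel g ginv x σ ν a * U x ![σ, b] := by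
  simp only [Matrix.vecCons, covD_cons, dirD_cons, dirD_rank_zero]

lemma covD_rank_four (U : Tensor n 4) (x : Pt n) (ν a b c d : Fin n) :
    covD g ginv U x ![ν, a, b, c, d] = pd ν (fun y => U y ![a, b, c, d]) x -
      ∑ σ, christoffel g ginv x σ ν d * U x ![a, b, c, σ] -
      ∑ σ, christoffel g ginv x σ ν c * U x ![a, b, σ, d] -
      ∑ σ, christoffel g ginv x σ ν b * U x ![a, σ, c, d] -
      ∑ σ, christoffel g ginv x σ ν a * U x ![σ, b, c, d] := by
  simp only [Matrix.vecCons, covD_cons, dirD_cons, dirD_rank_zero]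

lemma covD_rank_five (U : Tensor n 5) (x : Pt n) (τ ν a b c d : Fin n) :
    covD g ginv U x ![τ, ν, a, b, c, d] = pd τ (fun y => U y ![ν, a, b, c, d]) x -
      ∑ σ, christoffel g ginv x σ τ d * U x ![ν, a, b, c, σ] -
      ∑ σ, christoffel g ginv x σ τ c * U x ![ν, a, b, σ, d] -
      ∑ σ, christoffel g ginv x σ τ b * U x ![ν, a, σ, c, d] -
      ∑ σ, christoffel g ginv x σ τ a * U x ![ν, σ, b, c, d] -
      ∑ σ, christoffel g ginv x σ τ ν * U x ![σ, a, b, c, d] := by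
  simp only [Matrix.vecCons, covD_cons, dirD_cons, dirD_rank_zero]

lemma covD_riemann (hg : IsMetric g ginv) (x : Pt n) (ν a b c d : Fin n) :
    covD g ginv (riemann g ginv) x ![ν, a, b, c, d] =
      ∑ ρ, g x a ρ * dRiemannMatrix g ginv ν c d x ρ b := by
  have h := pd_sum_metric_mul hg (V := fun y ρ => riemannUp g ginv y ρ b c d)
    (fun _ => contDiff_riemannUp hg _ _ _ _) ν a x
  rw [covD_rank_four]
  simp only [riemann_vec, dRiemannMatrix_apply]
  simp only [mul_add, mul_sub, Finset.sum_add_distrib, Finset.sum_sub_distrib] at h ⊢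
  rw [← sum_mul_sum_metric_mul (fun σ => christoffel g ginv x σ ν b) (g x a)
      (fun σ ρ => riemannUp g ginv x ρ σ c d),
    ← sum_mul_sum_metric_mul (fun σ => christoffel g ginv x σ ν c) (g x a)
      (fun σ ρ => riemannUp g ginv x ρ b σ d),
    ← sum_mul_sum_metric_mul (fun σ => christoffel g ginv x σ ν d) (g x a)
      (fun σ ρ => riemannUp g ginv x ρ b c σ)]
  linarith

lemma covD_covD_riemann (hg : IsMetric g ginv) (x : Pt n) (τ ν a b c d : Fin n) :
    covD g ginv (covD g ginv (riemann g ginv)) x ![τ, ν, a, b, c, d] =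
      ∑ ρ, g x a ρ * ddRiemannMatrix g ginv τ ν c d x ρ b := by
  have h := pd_sum_metric_mul hg (V := fun y ρ => dRiemannMatrix g ginv ν c d y ρ b)
    (fun _ => contDiff_dRiemannMatrix hg _ _ _ _ _) τ a x
  rw [covD_rank_five]
  simp only [covD_riemann hg, ddRiemannMatrix_apply]
  simp only [mul_add, mul_sub, Finset.sum_add_distrib, Finset.sum_sub_distrib] at h ⊢
  rw [← sum_mul_sum_metric_mul (fun σ => christoffel g ginv x σ τ b) (g x a)
      (fun σ ρ => dRiemannMatrix g ginv ν c d x ρ σ),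
    ← sum_mul_sum_metric_mul (fun σ => christoffel g ginv x σ τ ν) (g x a)
      (fun σ ρ => dRiemannMatrix g ginv σ c d x ρ b),
    ← sum_mul_sum_metric_mul (fun σ => christoffel g ginv x σ τ c) (g x a)
      (fun σ ρ => dRiemannMatrix g ginv ν σ d x ρ b),
    ← sum_mul_sum_metric_mul (fun σ => christoffel g ginv x σ τ d) (g x a)
      (fun σ ρ => dRiemannMatrix g ginv ν c σ x ρ b)]
  linarith

lemma ddRiemannMatrix_eq_zero (hg : IsMetric g ginv) (h2 : TwoSymmetric g ginv)
    (τ ν c d : Fin n) (x : Pt n) : ddRiemannMatrix g ginv τ ν c d x = 0 := by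
  ext ρ b
  rw [← sum_inv_mul_sum_metric hg x (fun ρ => ddRiemannMatrix g ginv τ ν c d x ρ b) ρ]
  simp only [← covD_covD_riemann hg, h2 x, mul_zero, Finset.sum_const_zero, Matrix.zero_apply]

lemma covD_ricci (hg : IsMetric g ginv) (x : Pt n) (ν a b : Fin n) :
    covD g ginv (ricci g ginv) x ![ν, a, b] = ∑ ρ, dRiemannMatrix g ginv ν ρ b x ρ a := by
  have hr : ∀ y a b, ricci g ginv y ![a, b] = ∑ ρ, riemannUp g ginv y ρ a ρ b :=
    fun _ _ _ => rfl
  rw [covD_rank_two]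
  simp only [hr, dRiemannMatrix_apply, Finset.sum_add_distrib, Finset.sum_sub_distrib]
  rw [pd_sum _ _ fun ρ => contDiff_riemannUp hg _ _ _ _]
  have e0 : ∑ ρ, ∑ σ, christoffel g ginv x ρ ν σ * riemannUp g ginv x σ a ρ b =
      ∑ ρ, ∑ σ, christoffel g ginv x σ ν ρ * riemannUp g ginv x ρ a σ b := Finset.sum_comm
  have e1 : ∑ ρ, ∑ σ, christoffel g ginv x σ ν a * riemannUp g ginv x ρ σ ρ b =
      ∑ σ, christoffel g ginv x σ ν a * ∑ ρ, riemannUp g ginv x ρ σ ρ b := by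
    rw [Finset.sum_comm]; simp only [Finset.mul_sum]
  have e2 : ∑ ρ, ∑ σ, christoffel g ginv x σ ν b * riemannUp g ginv x ρ a ρ σ =
      ∑ σ, christoffel g ginv x σ ν b * ∑ ρ, riemannUp g ginv x ρ a ρ σ := by
    rw [Finset.sum_comm]; simp only [Finset.mul_sum]
  rw [e0, e1, e2]
  ring

lemma covD_ricci_eq_contraction (hg : IsMetric g ginv) (x : Pt n) (ν a b : Fin n) :
    covD g ginv (ricci g ginv) x ![ν, a, b] =
      ∑ κ, ∑ ρ, ginv x κ ρ * covD g ginv (riemann g ginv) x ![ν, ρ, a, κ, b] := by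
  simp only [covD_ricci hg, covD_riemann hg]
  exact Finset.sum_congr rfl fun κ _ =>
    (sum_inv_mul_sum_metric hg x (fun ρ => dRiemannMatrix g ginv ν κ b x ρ a) κ).symm

lemma covD_riemann_antisymm_left (hg : IsMetric g ginv) (x : Pt n) (ν a b c d : Fin n) :
    covD g ginv (riemann g ginv) x ![ν, a, b, c, d] =
      -covD g ginv (riemann g ginv) x ![ν, b, a, c, d] := by
  rw [covD_riemann hg, covD_riemann hg, sum_metric_mul_dRiemannMatrix_antisymm hg]

lemma covD_riemann_antisymm_right (hg : IsMetric g ginv) (x : Pt n) (ν a b c d : Fin n) :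
    covD g ginv (riemann g ginv) x ![ν, a, b, c, d] =
      -covD g ginv (riemann g ginv) x ![ν, a, b, d, c] := by
  simp only [covD_riemann hg, dRiemannMatrix_antisymm ν c d, mul_neg, Finset.sum_neg_distrib]

lemma covD_riemann_cyclic (hg : IsMetric g ginv) (x : Pt n) (ν a b c d : Fin n) :
    covD g ginv (riemann g ginv) x ![ν, a, b, c, d] +
      covD g ginv (riemann g ginv) x ![ν, a, c, d, b] +
      covD g ginv (riemann g ginv) x ![ν, a, d, b, c] = 0 := by
  simp only [covD_riemann hg, ← Finset.sum_add_distrib, ← mul_add, dRiemannMatrix_cyclic hg,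
    mul_zero, Finset.sum_const_zero]

lemma covD_riemann_pair_symm (hg : IsMetric g ginv) (x : Pt n) (ν a b c d : Fin n) :
    covD g ginv (riemann g ginv) x ![ν, a, b, c, d] =
      covD g ginv (riemann g ginv) x ![ν, c, d, a, b] := by
  have hl := covD_riemann_antisymm_left hg x ν
  have hr := covD_riemann_antisymm_right hg x ν
  have hc := covD_riemann_cyclic hg x ν
  linarith [hc a b c d, hc b c d a, hc c d a b, hc d a b c, hl b c d a, hl b d a c, hr b a c d,
    hl a b c d, hl c a b d, hl c b d a, hr c d a b, hl d a b c, hl d b c a, hr d c a b,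
    hl d c a b, hr a c d b, hr a d b c, hr b c a d, hr b d a c, hl b a c d, hr c b a d,
    hr c a b d, hr a c b d, hr d a b c, hr d b a c, hl d a c b, hr c b d a, hl c a d b,
    hr d a c b, hr d b c a, hl c b a d, hl d b a c, hr c a d b, hl d c b a, hr b a d c]

lemma covD_riemann_cyclic_deriv (hg : IsMetric g ginv) (x : Pt n) (ν a b c d : Fin n) :
    covD g ginv (riemann g ginv) x ![ν, a, b, c, d] +
      covD g ginv (riemann g ginv) x ![c, a, b, d, ν] +
      covD g ginv (riemann g ginv) x ![d, a, b, ν, c] = 0 := by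
  have h : ∀ ρ, dRiemannMatrix g ginv ν c d x ρ b + dRiemannMatrix g ginv c d ν x ρ b +
      dRiemannMatrix g ginv d ν c x ρ b = 0 := fun ρ =>
    congrArg (fun M : Matrix (Fin n) (Fin n) ℝ => M ρ b) (dRiemannMatrix_cyclic_deriv hg ν c d x)
  simp only [covD_riemann hg, ← Finset.sum_add_distrib, ← mul_add, h, mul_zero,
    Finset.sum_const_zero]

lemma covD_ricci_symm (hg : IsMetric g ginv) (x : Pt n) (ν a b : Fin n) :
    covD g ginv (ricci g ginv) x ![ν, a, b] = covD g ginv (ricci g ginv) x ![ν, b, a] := by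
  rw [covD_ricci_eq_contraction hg, covD_ricci_eq_contraction hg, Finset.sum_comm]
  exact Finset.sum_congr rfl fun κ _ => Finset.sum_congr rfl fun ρ _ => by
    rw [inv_symm hg, covD_riemann_pair_symm hg]

/-- The symmetrised `∇_{(τ} R_{ν) a λ μ}`, contracted over `ν` and `λ`. -/
lemma sum_inv_mul_covD_riemann (hg : IsMetric g ginv) (x : Pt n) (τ a μ : Fin n) :
    ∑ ν, ∑ lam, ginv x ν lam * (covD g ginv (riemann g ginv) x ![τ, a, ν, lam, μ] +
      covD g ginv (riemann g ginv) x ![ν, a, τ, lam, μ]) =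
    covD g ginv (ricci g ginv) x ![a, μ, τ] - 2 * covD g ginv (ricci g ginv) x ![τ, a, μ] := by
  have h : ∀ ν lam, covD g ginv (riemann g ginv) x ![τ, a, ν, lam, μ] +
      covD g ginv (riemann g ginv) x ![ν, a, τ, lam, μ] =
      covD g ginv (riemann g ginv) x ![a, lam, μ, ν, τ] -
        covD g ginv (riemann g ginv) x ![τ, lam, μ, ν, a] -
        covD g ginv (riemann g ginv) x ![τ, lam, μ, ν, a] := by
    intro ν lam
    rw [covD_riemann_pair_symm hg x τ a ν, covD_riemann_pair_symm hg x ν a τ]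
    linarith [covD_riemann_cyclic_deriv hg x ν lam μ a τ,
      covD_riemann_antisymm_right hg x τ lam μ a ν, covD_riemann_antisymm_right hg x a lam μ τ ν]
  simp only [h, mul_sub, Finset.sum_sub_distrib, ← covD_ricci_eq_contraction hg]
  rw [covD_ricci_symm hg x τ μ a]
  ring

end Contractions

/-- In an `n`-dimensional 2-symmetric semi-Riemannian manifold of any
signature, if a tensor field `T` satisfies `∇_λ ∇_μ T_{α₁…α_q} = 0`, then the Ricci
tensor satisfies `(∇_ν R^ρ_μ - ∇_μ R^ρ_ν) ∇_ρ T = 0` and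
`(∇^ρ R_{μν} - 2 ∇_ν R^ρ_μ) ∇_ρ T = 0`. -/
theorem stmt4 {n q : ℕ} (g ginv : Pt n → Fin n → Fin n → ℝ) (hg : IsMetric g ginv)
    (h2 : TwoSymmetric g ginv)
    (T : Tensor n q) (hT : ∀ idx, ContDiff ℝ (⊤ : ℕ∞) fun x => T x idx)
    (hTpar : ∀ x idx, covD g ginv (covD g ginv T) x idx = 0) :
    (∀ (x : Pt n) (ν μ : Fin n) (α : Fin q → Fin n),
      (∑ ρ, ∑ σ, ginv x ρ σ *
        (covD g ginv (ricci g ginv) x ![ν, σ, μ] - covD g ginv (ricci g ginv) x ![μ, σ, ν]) *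
        covD g ginv T x (Fin.cons ρ α)) = 0) ∧
    (∀ (x : Pt n) (μ ν : Fin n) (α : Fin q → Fin n),
      (∑ ρ, ∑ σ, ginv x ρ σ *
        (covD g ginv (ricci g ginv) x ![σ, μ, ν] - 2 * covD g ginv (ricci g ginv) x ![ν, σ, μ]) *
        covD g ginv T x (Fin.cons ρ α)) = 0) := by
  have key : ∀ (x : Pt n) (μ τ : Fin n) (α : Fin q → Fin n),
      (∑ ρ, ∑ σ, ginv x ρ σ *
        (covD g ginv (ricci g ginv) x ![σ, μ, τ] - 2 * covD g ginv (ricci g ginv) x ![τ, σ, μ]) *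
        covD g ginv T x (Fin.cons ρ α)) = 0 := by
    intro x μ τ α
    have hD : ∀ ν lam, ∑ ρ, ∑ σ, ginv x ρ σ *
        (covD g ginv (riemann g ginv) x ![τ, σ, ν, lam, μ] +
          covD g ginv (riemann g ginv) x ![ν, σ, τ, lam, μ]) *
        covD g ginv T x (Fin.cons ρ α) = 0 := by
      intro ν lam
      rw [← sum_dRiemannMatrix_add_mul_dirD hg (ddRiemannMatrix_eq_zero hg h2) hT hTpar
        τ ν lam μ x α]
      refine Finset.sum_congr rfl fun ρ _ => ?_
      rw [← Finset.sum_mul, covD_cons]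
      congr 1
      simp only [covD_riemann hg, ← Finset.sum_add_distrib, ← mul_add]
      exact sum_inv_mul_sum_metric hg x (fun ρ =>
        dRiemannMatrix g ginv τ lam μ x ρ ν + dRiemannMatrix g ginv ν lam μ x ρ τ) ρ
    have hz : ∑ ν, ∑ lam, ginv x ν lam * ∑ ρ, ∑ σ, ginv x ρ σ *
        (covD g ginv (riemann g ginv) x ![τ, σ, ν, lam, μ] +
          covD g ginv (riemann g ginv) x ![ν, σ, τ, lam, μ]) *
        covD g ginv T x (Fin.cons ρ α) = 0 := by
      simp only [hD, mul_zero, Finset.sum_const_zero]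
    rw [← hz]
    simp only [← sum_inv_mul_covD_riemann hg, Finset.mul_sum, Finset.sum_mul,
      ← Fintype.sum_prod_type']
    exact Fintype.sum_equiv ⟨fun p => (p.2.2.1, p.2.2.2, p.1, p.2.1),
      fun p => (p.2.2.1, p.2.2.2, p.1, p.2.1), fun _ => rfl, fun _ => rfl⟩ _ _
      fun _ => by simp only [Equiv.coe_fn_mk]; ring
  refine ⟨fun x ν μ α => ?_, key⟩
  have h : (∑ ρ, ∑ σ, ginv x ρ σ *
      (covD g ginv (ricci g ginv) x ![ν, σ, μ] - covD g ginv (ricci g ginv) x ![μ, σ, ν]) *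
      covD g ginv T x (Fin.cons ρ α)) = (1 / 2) *
      ((∑ ρ, ∑ σ, ginv x ρ σ *
        (covD g ginv (ricci g ginv) x ![σ, ν, μ] - 2 * covD g ginv (ricci g ginv) x ![μ, σ, ν]) *
        covD g ginv T x (Fin.cons ρ α)) -
      ∑ ρ, ∑ σ, ginv x ρ σ *
        (covD g ginv (ricci g ginv) x ![σ, μ, ν] - 2 * covD g ginv (ricci g ginv) x ![ν, σ, μ]) *
        covD g ginv T x (Fin.cons ρ α)) := by
    simp only [← Finset.sum_sub_distrib, Finset.mul_sum]
    refine Finset.sum_congr rfl fun ρ _ => Finset.sum_congr rfl fun σ _ => ?_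
    rw [covD_ricci_symm hg x σ ν μ]
    ring
  rw [h, key, key]
  norm_num
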